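/- (Analytic core of the specific-volume bounds for β < −3.) Let γ > 1, let β be a real number with −γ−2 < β < −3, and let E > 0. Then there exists a constant C ≥ 1, depending only on β, γ and E, such that every continuously differentiable function v : [0,∞) → (0,∞) satisfying v(x) → 1 as x → ∞, ∫₀^∞ Φ(v(x)) dx ≤ E and ∫₀^∞ v′(x)² / v(x)^{β+5} dx ≤ E obeys C⁻¹ ≤ v(x) ≤ C for all x ≥ 0. -/

import Mathlib

open MeasureTheory Real Filter Topology Set

noncomputable section

/-- The pressure potential `Φ(v) = ∫₁^v (1 - s^(-γ)) ds`. -/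
def Phi (γ v : ℝ) : ℝ := ∫ s in (1:ℝ)..v, (1 - s ^ (-γ))

/-- Closed form of the pressure potential. -/
theorem Phi_eq {γ s : ℝ} (hγ : 1 < γ) (hs : 0 < s) :
    Phi γ s = s - 1 + (s ^ (1 - γ) - 1) / (γ - 1) := by
  have h0 : (0 : ℝ) ∉ uIcc 1 s := fun h => (lt_min one_pos hs).not_ge h.1
  have hint : IntervalIntegrable (fun t : ℝ => t ^ (-γ)) volume 1 s :=
    intervalIntegral.intervalIntegrable_rpow (Or.inr h0)
  have hne : γ - 1 ≠ 0 := by linarith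
  have hne' : 1 - γ ≠ 0 := by linarith
  rw [Phi, intervalIntegral.integral_sub (by simp) hint,
    integral_rpow (Or.inr ⟨by linarith, h0⟩), show -γ + 1 = 1 - γ by ring]
  simp only [intervalIntegral.integral_const, smul_eq_mul, mul_one, one_rpow]
  field_simp
  ring

theorem Phi_nonneg {γ s : ℝ} (hγ : 1 < γ) (hs : 0 < s) : 0 ≤ Phi γ s := by
  have h1 : Real.log s * (1 - γ) + 1 ≤ s ^ (1 - γ) := by
    rw [rpow_def_of_pos hs]
    exact add_one_le_exp _
  have h2 : -Real.log s ≤ (s ^ (1 - γ) - 1) / (γ - 1) := by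
    rw [le_div_iff₀ (by linarith)]
    linarith
  rw [Phi_eq hγ hs]
  linarith [log_le_sub_one_of_pos hs]

theorem continuousOn_Phi {γ : ℝ} (hγ : 1 < γ) : ContinuousOn (Phi γ) (Ioi 0) := by
  have h : ContinuousOn (fun s : ℝ => s - 1 + (s ^ (1 - γ) - 1) / (γ - 1)) (Ioi 0) := by
    have : ContinuousOn (fun s : ℝ => s ^ (1 - γ)) (Ioi 0) :=
      continuousOn_id.rpow_const fun s hs => Or.inl (ne_of_gt hs)
    fun_prop
  exact h.congr fun s hs => Phi_eq hγ hs

/-- The integrand `√Φ(s) s^(-p/2)` of Kanel's auxiliary function. -/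
def kanelDensity (γ p s : ℝ) : ℝ := √(Phi γ s) * s ^ (-p / 2)

/-- Kanel's auxiliary function `∫₁^v √Φ(s) s^(-p/2) ds`. -/
def kanel (γ p v : ℝ) : ℝ := ∫ s in (1:ℝ)..v, kanelDensity γ p s

theorem kanelDensity_nonneg {γ p s : ℝ} (hs : 0 < s) : 0 ≤ kanelDensity γ p s :=
  mul_nonneg (sqrt_nonneg _) (rpow_nonneg hs.le _)

theorem continuousOn_kanelDensity {γ p : ℝ} (hγ : 1 < γ) :
    ContinuousOn (kanelDensity γ p) (Ioi 0) :=
  (continuousOn_Phi hγ).sqrt.mul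
    (continuousOn_id.rpow_const fun _ hs => Or.inl (ne_of_gt hs))

theorem hasDerivAt_kanel {γ p s : ℝ} (hγ : 1 < γ) (hs : 0 < s) :
    HasDerivAt (kanel γ p) (kanelDensity γ p s) s := by
  have hc := continuousOn_kanelDensity (p := p) hγ
  have hsub : uIcc 1 s ⊆ Ioi 0 := fun t ht => lt_of_lt_of_le (lt_min one_pos hs) ht.1
  exact intervalIntegral.integral_hasDerivAt_right (hc.mono hsub).intervalIntegrable
    (hc.stronglyMeasurableAtFilter isOpen_Ioi s hs) (hc.continuousAt (Ioi_mem_nhds hs))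

theorem kanel_one (γ p : ℝ) : kanel γ p 1 = 0 := intervalIntegral.integral_same

theorem monotoneOn_kanel {γ p : ℝ} (hγ : 1 < γ) : MonotoneOn (kanel γ p) (Ioi 0) :=
  monotoneOn_of_hasDerivWithinAt_nonneg (convex_Ioi 0)
    (fun _ hs => (hasDerivAt_kanel hγ hs).continuousAt.continuousWithinAt)
    (fun s hs => (hasDerivAt_kanel hγ (by simpa using hs)).hasDerivWithinAt)
    (fun _ hs => kanelDensity_nonneg (by simpa using hs))

/-- Arithmetic–geometric mean estimate behind Kanel's argument. -/
theorem abs_kanelDensity_mul_le {γ p s : ℝ} (hγ : 1 < γ) (hs : 0 < s) (d : ℝ) :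
    |kanelDensity γ p s * d| ≤ (Phi γ s + d ^ 2 / s ^ p) / 2 := by
  have h1 : √(Phi γ s) ^ 2 = Phi γ s := sq_sqrt (Phi_nonneg hγ hs)
  have h2 : (s ^ (-p / 2)) ^ 2 = (s ^ p)⁻¹ := by
    rw [← rpow_natCast, ← rpow_mul hs.le, ← rpow_neg hs.le]
    congr 1
    push_cast
    ring
  have h3 : Phi γ s + d ^ 2 / s ^ p = √(Phi γ s) ^ 2 + (s ^ (-p / 2) * d) ^ 2 := by
    rw [h1, mul_pow, h2]
    ring
  rw [h3, kanelDensity, abs_le]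
  constructor
  · nlinarith [sq_nonneg (√(Phi γ s) + s ^ (-p / 2) * d)]
  · nlinarith [sq_nonneg (√(Phi γ s) - s ^ (-p / 2) * d)]

/-- The energy bounds control Kanel's auxiliary function along `v`. -/
theorem abs_kanel_le {γ p E : ℝ} (hγ : 1 < γ) {v : ℝ → ℝ} (hpos : ∀ x, 0 ≤ x → 0 < v x)
    (hv : ContDiffOn ℝ 1 v (Ici 0)) (hlim : Tendsto v atTop (𝓝 1))
    (hΦ : IntegrableOn (fun x => Phi γ (v x)) (Ioi 0))
    (hΦE : ∫ x in Ioi (0:ℝ), Phi γ (v x) ≤ E)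
    (hd : IntegrableOn (fun x => deriv v x ^ 2 / v x ^ p) (Ioi 0))
    (hdE : ∫ x in Ioi (0:ℝ), deriv v x ^ 2 / v x ^ p ≤ E) {x : ℝ} (hx : 0 ≤ x) :
    |kanel γ p (v x)| ≤ E := by
  set φ : ℝ → ℝ := fun x => (Phi γ (v x) + deriv v x ^ 2 / v x ^ p) / 2 with hφ
  have hφint : IntegrableOn φ (Ioi 0) := (hΦ.add hd).div_const 2
  have hφE : ∫ t in Ioi (0:ℝ), φ t ≤ E := by
    rw [hφ, integral_div, integral_add hΦ hd]
    linarith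
  have hφnn : ∀ t, 0 < t → 0 ≤ φ t := fun t ht =>
    (abs_nonneg _).trans (abs_kanelDensity_mul_le hγ (hpos t ht.le) (deriv v t))
  have hderiv : ∀ t, 0 < t →
      HasDerivAt (fun t => kanel γ p (v t)) (kanelDensity γ p (v t) * deriv v t) t := by
    intro t ht
    have hdv : HasDerivAt v (deriv v t) t :=
      ((hv.differentiableOn (by norm_num)).differentiableAt (Ici_mem_nhds ht)).hasDerivAt
    exact (hasDerivAt_kanel hγ (hpos t ht.le)).comp t hdv
  have hcont : ContinuousOn (fun t => kanel γ p (v t)) (Ici 0) := fun t ht =>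
    (hasDerivAt_kanel hγ (hpos t ht)).continuousAt.comp_continuousWithinAt
      (hv.continuousOn t ht)
  have hdiff : ∀ y, x ≤ y → |kanel γ p (v y) - kanel γ p (v x)| ≤ E := by
    intro y hxy
    have hIoc : Ioc x y ⊆ Ioi 0 := fun t ht => hx.trans_lt ht.1
    have hIcc : IntegrableOn φ (Icc x y) := by
      rw [integrableOn_Icc_iff_integrableOn_Ioc]
      exact hφint.mono_set hIoc
    have hle : ∫ t in x..y, φ t ≤ E := by
      rw [intervalIntegral.integral_of_le hxy]
      refine le_trans (setIntegral_mono_set hφint ?_ hIoc.eventuallyLE) hφE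
      filter_upwards [ae_restrict_mem measurableSet_Ioi] with t ht using hφnn t ht
    have hc : ContinuousOn (fun t => kanel γ p (v t)) (Icc x y) :=
      hcont.mono fun t ht => hx.trans ht.1
    have hbd : ∀ t ∈ Ioo x y, |kanelDensity γ p (v t) * deriv v t| ≤ φ t := fun t ht =>
      abs_kanelDensity_mul_le hγ (hpos t (hx.trans ht.1.le)) _
    have hup := intervalIntegral.sub_le_integral_of_hasDeriv_right_of_le hxy hc
      (fun t ht => (hderiv t (hx.trans_lt ht.1)).hasDerivWithinAt) hIcc
      (fun t ht => (le_abs_self _).trans (hbd t ht))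
    have hdown := intervalIntegral.sub_le_integral_of_hasDeriv_right_of_le hxy hc.neg
      (fun t ht => (hderiv t (hx.trans_lt ht.1)).neg.hasDerivWithinAt) hIcc
      (fun t ht => (neg_le_abs _).trans (hbd t ht))
    simp only [Pi.neg_apply] at hdown
    rw [abs_le]
    constructor <;> linarith
  have hlim' : Tendsto (fun y => |kanel γ p (v y) - kanel γ p (v x)|) atTop
      (𝓝 |kanel γ p 1 - kanel γ p (v x)|) :=
    (((hasDerivAt_kanel hγ one_pos).continuousAt.tendsto.comp hlim).sub_const _).abs
  have := le_of_tendsto hlim' ((eventually_ge_atTop x).mono hdiff)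
  rwa [kanel_one, zero_sub, abs_neg] at this

/-- A differentiable function whose derivative dominates `k / s` grows at least like `k log s`. -/
theorem mul_log_sub_log_le_sub {f f' : ℝ → ℝ} {k a b : ℝ} (ha : 0 < a) (hab : a ≤ b)
    (hf : ∀ s ∈ Icc a b, HasDerivAt f (f' s) s) (hk : ∀ s ∈ Icc a b, k / s ≤ f' s) :
    k * (Real.log b - Real.log a) ≤ f b - f a := by
  have hder : ∀ s ∈ Icc a b, HasDerivAt (fun s => f s - k * Real.log s) (f' s - k * s⁻¹) s :=
    fun s hs => (hf s hs).sub ((hasDerivAt_log (ha.trans_le hs.1).ne').const_mul k)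
  have hmono : MonotoneOn (fun s => f s - k * Real.log s) (Icc a b) :=
    monotoneOn_of_hasDerivWithinAt_nonneg (convex_Icc a b)
      (fun s hs => (hder s hs).continuousAt.continuousWithinAt)
      (fun s hs => (hder s (interior_subset hs)).hasDerivWithinAt)
      (fun s hs => by
        have := hk s (interior_subset hs)
        rw [div_eq_mul_inv] at this
        linarith)
  have := hmono (left_mem_Icc.2 hab) (right_mem_Icc.2 hab) hab
  simp only at this
  linarith

/-- Lower bound for the density at large specific volume. -/
theorem inv_le_kanelDensity {γ p s : ℝ} (hγ : 1 < γ) (hp : p ≤ 2)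
    (hs : 1 + γ / (γ - 1) ≤ s) : 1 / s ≤ kanelDensity γ p s := by
  have hq : 0 < γ / (γ - 1) := div_pos (by linarith) (by linarith)
  have hs0 : 0 < s := by linarith
  have hΦ : 1 ≤ Phi γ s := by
    rw [Phi_eq hγ hs0]
    have h1 : γ / (γ - 1) = 1 + 1 / (γ - 1) := by
      have : γ - 1 ≠ 0 := by linarith
      field_simp
      ring
    have h2 : 0 ≤ s ^ (1 - γ) / (γ - 1) := div_nonneg (rpow_nonneg hs0.le _) (by linarith)
    rw [sub_div]
    linarith
  have hpow : s⁻¹ ≤ s ^ (-p / 2) := by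
    rw [← rpow_neg_one]
    exact rpow_le_rpow_of_exponent_le (by linarith) (by linarith)
  have := mul_le_mul (one_le_sqrt.2 hΦ) hpow (by positivity) (sqrt_nonneg _)
  rwa [one_mul, ← one_div] at this

/-- Lower bound for the density at small specific volume. -/
theorem div_le_kanelDensity {γ p s : ℝ} (hγ : 1 < γ) (hp : 3 - γ ≤ p) (hs : 0 < s)
    (hs' : s ≤ (2 * γ) ^ (1 - γ)⁻¹) : √(1 / (2 * (γ - 1))) / s ≤ kanelDensity γ p s := by
  have hγ0 : 0 < γ - 1 := by linarith
  have hs1 : s ≤ 1 := hs'.trans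
    (rpow_le_one_of_one_le_of_nonpos (by linarith) (inv_nonpos.2 (by linarith)))
  have hbig : 2 * γ ≤ s ^ (1 - γ) := by
    have := rpow_le_rpow_of_nonpos hs hs' (show 1 - γ ≤ 0 by linarith)
    rwa [← rpow_mul (by linarith), inv_mul_cancel₀ (by linarith), rpow_one] at this
  have hΦ : 1 / (2 * (γ - 1)) * s ^ (1 - γ) ≤ Phi γ s := by
    rw [Phi_eq hγ hs]
    have h : s - 1 + (s ^ (1 - γ) - 1) / (γ - 1) - 1 / (2 * (γ - 1)) * s ^ (1 - γ)
        = s + (s ^ (1 - γ) - 2 * γ) / (2 * (γ - 1)) := by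
      field_simp
      ring
    have : 0 ≤ (s ^ (1 - γ) - 2 * γ) / (2 * (γ - 1)) := div_nonneg (by linarith) (by linarith)
    linarith
  have hsqrt : √(1 / (2 * (γ - 1))) * s ^ ((1 - γ) / 2) ≤ √(Phi γ s) := by
    have := sqrt_le_sqrt hΦ
    rwa [sqrt_mul (by positivity), sqrt_eq_rpow (s ^ (1 - γ)), ← rpow_mul hs.le,
      mul_one_div] at this
  have hpow : s⁻¹ ≤ s ^ ((1 - γ) / 2) * s ^ (-p / 2) := by
    rw [← rpow_neg_one, ← rpow_add hs]
    exact rpow_le_rpow_of_exponent_ge hs hs1 (by linarith)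
  calc √(1 / (2 * (γ - 1))) / s = √(1 / (2 * (γ - 1))) * s⁻¹ := div_eq_mul_inv _ _
    _ ≤ √(1 / (2 * (γ - 1))) * (s ^ ((1 - γ) / 2) * s ^ (-p / 2)) := by gcongr
    _ = √(1 / (2 * (γ - 1))) * s ^ ((1 - γ) / 2) * s ^ (-p / 2) := by ring
    _ ≤ kanelDensity γ p s := by
      rw [kanelDensity]
      gcongr

/-- Kanel's function is coercive at infinity. -/
theorem le_of_kanel_le {γ p E v : ℝ} (hγ : 1 < γ) (hp : p ≤ 2) (hE : 0 ≤ E)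
    (h : kanel γ p v ≤ E) : v ≤ (1 + γ / (γ - 1)) * exp E := by
  set b := 1 + γ / (γ - 1) with hb
  have hb1 : 1 < b := by
    have : 0 < γ / (γ - 1) := div_pos (by linarith) (by linarith)
    linarith
  have hb0 : 0 < b := by linarith
  rcases le_total v b with hvb | hbv
  · exact hvb.trans (le_mul_of_one_le_right hb0.le (one_le_exp hE))
  have h0 := mul_log_sub_log_le_sub hb0 hbv
    (fun s hs => hasDerivAt_kanel (p := p) hγ (hb0.trans_le hs.1))
    (fun s hs => inv_le_kanelDensity hγ hp hs.1)
  have h1 := monotoneOn_kanel (p := p) hγ (mem_Ioi.2 one_pos) hb0 hb1.le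
  rw [kanel_one] at h1
  have hv0 : 0 < v := hb0.trans_le hbv
  rw [← log_le_log_iff hv0 (by positivity), log_mul hb0.ne' (exp_ne_zero _), log_exp]
  linarith

/-- Kanel's function is coercive at vacuum. -/
theorem le_of_neg_le_kanel {γ p E v : ℝ} (hγ : 1 < γ) (hp : 3 - γ ≤ p) (hE : 0 ≤ E)
    (hv : 0 < v) (h : -E ≤ kanel γ p v) :
    (2 * γ) ^ (1 - γ)⁻¹ * exp (-(E / √(1 / (2 * (γ - 1))))) ≤ v := by
  have hk0 : 0 < √(1 / (2 * (γ - 1))) := sqrt_pos.2 (one_div_pos.2 (by linarith))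
  have ha0 : 0 < (2 * γ) ^ (1 - γ)⁻¹ := rpow_pos_of_pos (by linarith) _
  have ha1 : (2 * γ) ^ (1 - γ)⁻¹ ≤ 1 :=
    rpow_le_one_of_one_le_of_nonpos (by linarith) (inv_nonpos.2 (by linarith))
  have hdens := fun s (hs : 0 < s) => div_le_kanelDensity (s := s) hγ hp hs
  set k := √(1 / (2 * (γ - 1)))
  set a := (2 * γ) ^ (1 - γ)⁻¹
  rcases le_total a v with hav | hva
  · exact (mul_le_of_le_one_right ha0.le
      (exp_le_one_iff.2 (neg_nonpos.2 (by positivity)))).trans hav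
  have h0 := mul_log_sub_log_le_sub hv hva
    (fun s hs => hasDerivAt_kanel (p := p) hγ (hv.trans_le hs.1))
    (fun s hs => hdens s (hv.trans_le hs.1) hs.2)
  have h1 := monotoneOn_kanel (p := p) hγ ha0 (mem_Ioi.2 one_pos) ha1
  rw [kanel_one] at h1
  rw [← log_le_log_iff (by positivity) hv, log_mul ha0.ne' (exp_ne_zero _), log_exp]
  have h2 : Real.log a - Real.log v ≤ E / k := by
    rw [le_div_iff₀ hk0]
    linarith
  linarith

/-- **Analytic core of the specific-volume bounds** for `-γ-2 < β < -3`, `γ > 1`. -/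
theorem kanel_core_beta_lt_neg_three (β γ E : ℝ) (hγ : 1 < γ) (hβ₁ : -γ - 2 < β)
    (hβ₂ : β < -3) (hE : 0 < E) :
    ∃ C : ℝ, 1 ≤ C ∧ ∀ v : ℝ → ℝ,
      (∀ x : ℝ, 0 ≤ x → 0 < v x) →
      ContDiffOn ℝ 1 v (Ici (0:ℝ)) →
      Tendsto v atTop (𝓝 1) →
      IntegrableOn (fun x => Phi γ (v x)) (Ioi (0:ℝ)) →
      (∫ x in Ioi (0:ℝ), Phi γ (v x)) ≤ E →
      IntegrableOn (fun x => deriv v x ^ 2 / v x ^ (β + 5)) (Ioi (0:ℝ)) →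
      (∫ x in Ioi (0:ℝ), deriv v x ^ 2 / v x ^ (β + 5)) ≤ E →
      ∀ x : ℝ, 0 ≤ x → C⁻¹ ≤ v x ∧ v x ≤ C := by
  set M := (1 + γ / (γ - 1)) * exp E
  set m := (2 * γ) ^ (1 - γ)⁻¹ * exp (-(E / √(1 / (2 * (γ - 1)))))
  have hm : 0 < m := mul_pos (rpow_pos_of_pos (by linarith) _) (exp_pos _)
  refine ⟨max 1 (max M m⁻¹), le_max_left _ _, ?_⟩
  intro v hpos hv hlim hΦ hΦE hd hdE x hx
  have hK := abs_le.1 (abs_kanel_le hγ hpos hv hlim hΦ hΦE hd hdE hx)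
  have hlow : m ≤ v x := le_of_neg_le_kanel hγ (by linarith) hE.le (hpos x hx) hK.1
  have hup : v x ≤ M := le_of_kanel_le hγ (by linarith) hE.le hK.2
  refine ⟨le_trans ?_ hlow, hup.trans ((le_max_left _ _).trans (le_max_right _ _))⟩
  exact inv_le_of_inv_le₀ hm ((le_max_right _ _).trans (le_max_right _ _))
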